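/- Let (X,d,≪,≤,τ) be a finitely τ-measurable Lorentzian pre-length space, let γ ∈ TGeo(X) connect p = γ(0) to q = γ(1), and suppose there exists a timelike family F : U × V → TGeo(X) about γ that is continuous at γ. Then the following are equivalent: (i) p and q are not symmetrically conjugate along γ; (ii) F is a representative of the unique germ of timelike families continuous at γ, i.e., every timelike family about γ continuous at γ coincides with F on some product of neighborhoods of p and q. -/

import Mathlib

open Set Filter Topology NNReal ENNReal

noncomputable section

/-- A Lorentzian pre-length space structure on a metric space `X`. -/
structure LorentzianPreLengthSpace (X : Type*) [MetricSpace X] where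
  chron : X → X → Prop
  causal : X → X → Prop
  tau : X → X → ℝ≥0∞
  chron_trans : Transitive chron
  causal_trans : Transitive causal
  causal_refl : Reflexive causal
  chron_imp_causal : ∀ {x y : X}, chron x y → causal x y
  tau_lsc : LowerSemicontinuous fun p : X × X => tau p.1 p.2
  tau_eq_zero : ∀ {x y : X}, ¬ causal x y → tau x y = 0
  chron_iff_pos : ∀ x y : X, chron x y ↔ 0 < tau x y
  rev_triangle : ∀ x y z : X, causal x y → causal y z → tau x y + tau y z ≤ tau x z

variable {X : Type*} [MetricSpace X]

/-- `γ` is not constant on any non-trivial subinterval of `[a,b]`. -/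
def NowhereConstantOn (γ : ℝ → X) (a b : ℝ) : Prop :=
  ∀ s t : ℝ, a ≤ s → s < t → t ≤ b → ∃ u, s ≤ u ∧ u ≤ t ∧ γ u ≠ γ s

/-- A future-directed causal curve on `[a,b]`. -/
def IsCausalCurveOn (L : LorentzianPreLengthSpace X) (γ : ℝ → X) (a b : ℝ) : Prop :=
  (∃ K : ℝ≥0, LipschitzOnWith K γ (Icc a b)) ∧ NowhereConstantOn γ a b ∧
    ∀ s t : ℝ, a ≤ s → s < t → t ≤ b → L.causal (γ s) (γ t)

/-- A future-directed timelike curve on `[a,b]`. -/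
def IsTimelikeCurveOn (L : LorentzianPreLengthSpace X) (γ : ℝ → X) (a b : ℝ) : Prop :=
  (∃ K : ℝ≥0, LipschitzOnWith K γ (Icc a b)) ∧ NowhereConstantOn γ a b ∧
    ∀ s t : ℝ, a ≤ s → s < t → t ≤ b → L.chron (γ s) (γ t)

/-- The `τ`-length of a curve on `[a,b]`: the infimum over partitions
`a = t₀ < t₁ < ⋯ < t_N = b` of `Σᵢ τ(γ(tᵢ), γ(tᵢ₊₁))`. -/
def tauLength (L : LorentzianPreLengthSpace X) (γ : ℝ → X) (a b : ℝ) : ℝ≥0∞ :=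
  sInf { s : ℝ≥0∞ | ∃ (N : ℕ) (t : ℕ → ℝ), 1 ≤ N ∧ t 0 = a ∧ t N = b ∧
    StrictMonoOn t (Set.Iic N) ∧
    s = ∑ i ∈ Finset.range N, L.tau (γ (t i)) (γ (t (i + 1))) }

/-- A maximizer on `[a,b]`. -/
def IsMaximizerOn (L : LorentzianPreLengthSpace X) (γ : ℝ → X) (a b : ℝ) : Prop :=
  tauLength L γ a b = L.tau (γ a) (γ b)

/-- A geodesic on `[a,b]`: a causal curve each of whose points has a relative
neighborhood `[a',b'] ⊆ [a,b]` on which the curve is maximizing. -/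
def IsGeodesicOn (L : LorentzianPreLengthSpace X) (γ : ℝ → X) (a b : ℝ) : Prop :=
  IsCausalCurveOn L γ a b ∧
    ∀ t : ℝ, a ≤ t → t ≤ b → ∃ a' b' : ℝ, a ≤ a' ∧ a' ≤ t ∧ t ≤ b' ∧ b' ≤ b ∧
      (a' < t ∨ t = a) ∧ (t < b' ∨ t = b) ∧ IsMaximizerOn L γ a' b'

/-- Every causal curve has finite `τ`-length. -/
def FinitelyTauMeasurable (L : LorentzianPreLengthSpace X) : Prop :=
  ∀ (γ : ℝ → X) (a b : ℝ), a < b → IsCausalCurveOn L γ a b → tauLength L γ a b < ⊤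

/-- A parametrization: a continuous, strictly increasing, surjective self-map of `[0,1]`. -/
def IsParam (φ : ℝ → ℝ) : Prop :=
  ContinuousOn φ (Icc 0 1) ∧ StrictMonoOn φ (Icc 0 1) ∧ φ '' Icc 0 1 = Icc 0 1

/-- Two paths are equivalent if one is a reparametrization of the other. -/
def PathEquiv (γ σ : ℝ → X) : Prop :=
  ∃ φ : ℝ → ℝ, IsParam φ ∧ ∀ t ∈ Icc (0:ℝ) 1, γ t = σ (φ t)

/-- The Fréchet distance of two paths `[0,1] → X`. -/
def frechetDist (γ σ : ℝ → X) : ℝ :=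
  sInf { r : ℝ | ∃ φ ψ : ℝ → ℝ, IsParam φ ∧ IsParam ψ ∧
    ∀ t ∈ Icc (0:ℝ) 1, dist (γ (φ t)) (σ (ψ t)) ≤ r }

/-- The metric `d_Γ` combining Fréchet distance and `τ`-length difference. -/
def dGamma (L : LorentzianPreLengthSpace X) (γ σ : ℝ → X) : ℝ :=
  frechetDist γ σ + |(tauLength L γ 0 1).toReal - (tauLength L σ 0 1).toReal|

/-- `γ` (parametrized on `[0,1]`) represents an element of `TGeo(X)`. -/
def InTGeo (L : LorentzianPreLengthSpace X) (γ : ℝ → X) : Prop :=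
  IsTimelikeCurveOn L γ 0 1 ∧ IsGeodesicOn L γ 0 1


/-- Convergence of a sequence of paths with respect to the metric `d_Γ`. -/
def DGammaTendsto (L : LorentzianPreLengthSpace X) (γs : ℕ → ℝ → X) (γ : ℝ → X) : Prop :=
  Tendsto (fun i => dGamma L (γs i) γ) atTop (𝓝 0)

/-- `p` and `q` are symmetrically conjugate along `γ ∈ TGeo(X)`: there are `pᵢ → p`,
`qᵢ → q` and, for each `i`, two distinct timelike geodesics from `pᵢ` to `qᵢ`, both
converging to `γ` with respect to `d_Γ`. -/
def SymmConjugate (L : LorentzianPreLengthSpace X) (γ : ℝ → X) (p q : X) : Prop :=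
  ∃ (ps qs : ℕ → X) (γs σs : ℕ → ℝ → X),
    Tendsto ps atTop (𝓝 p) ∧ Tendsto qs atTop (𝓝 q) ∧
    (∀ i, InTGeo L (γs i) ∧ InTGeo L (σs i) ∧
      γs i 0 = ps i ∧ γs i 1 = qs i ∧ σs i 0 = ps i ∧ σs i 1 = qs i ∧
      ¬ PathEquiv (γs i) (σs i)) ∧
    DGammaTendsto L γs γ ∧ DGammaTendsto L σs γ

/-- `F` is a timelike family about `γ` on `U × V`. -/
def IsTimelikeFamily (L : LorentzianPreLengthSpace X) (γ : ℝ → X) (U V : Set X)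
    (F : X → X → ℝ → X) : Prop :=
  U ∈ 𝓝 (γ 0) ∧ V ∈ 𝓝 (γ 1) ∧
  (∀ p' ∈ U, ∀ q' ∈ V, L.chron p' q') ∧
  (∀ p' ∈ U, ∀ q' ∈ V, InTGeo L (F p' q') ∧ F p' q' 0 = p' ∧ F p' q' 1 = q') ∧
  PathEquiv (F (γ 0) (γ 1)) γ

/-- The family `F` is continuous (with respect to `d_Γ`) at `γ`, i.e. at `(γ 0, γ 1)`. -/
def FamilyContinuousAt (L : LorentzianPreLengthSpace X) (γ : ℝ → X) (U V : Set X)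
    (F : X → X → ℝ → X) : Prop :=
  ∀ ε > (0:ℝ), ∃ δ > (0:ℝ), ∀ p' ∈ U, ∀ q' ∈ V,
    dist p' (γ 0) < δ → dist q' (γ 1) < δ → dGamma L (F p' q') γ < ε

/-- The family `F` is continuous (with respect to `d_Γ`) about `γ`, i.e. on all of `U × V`. -/
def FamilyContinuousAbout (L : LorentzianPreLengthSpace X) (γ : ℝ → X) (U V : Set X)
    (F : X → X → ℝ → X) : Prop :=
  ∀ p ∈ U, ∀ q ∈ V, ∀ ε > (0:ℝ), ∃ δ > (0:ℝ), ∀ p' ∈ U, ∀ q' ∈ V,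
    dist p' p < δ → dist q' q < δ → dGamma L (F p' q') (F p q) < ε

/-- Two timelike families (defined on `U × V` resp. `U' × V'`) coincide, as maps into
`TGeo(X)`, on a product of neighborhoods `U'' × V''` of `(p, q)` inside the common domain. -/
def FamiliesAgreeNear (p q : X) (U V U' V' : Set X) (F F' : X → X → ℝ → X) : Prop :=
  ∃ U'' ∈ 𝓝 p, ∃ V'' ∈ 𝓝 q, U'' ⊆ U ∩ U' ∧ V'' ⊆ V ∩ V' ∧
    ∀ x ∈ U'', ∀ y ∈ V'', PathEquiv (F x y) (F' x y)

/-- There is a unique (germ of a) timelike family about `γ` that is continuous at `γ`. -/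
def UniqueContFamilyAt (L : LorentzianPreLengthSpace X) (γ : ℝ → X) : Prop :=
  (∃ U V F, IsTimelikeFamily L γ U V F ∧ FamilyContinuousAt L γ U V F) ∧
  (∀ U V F U' V' F', IsTimelikeFamily L γ U V F → FamilyContinuousAt L γ U V F →
    IsTimelikeFamily L γ U' V' F' → FamilyContinuousAt L γ U' V' F' →
    FamiliesAgreeNear (γ 0) (γ 1) U V U' V' F F')

/-- `γ` is embeddable: there is a timelike family about `γ` that is continuous at `γ`. -/
def Embeddable (L : LorentzianPreLengthSpace X) (γ : ℝ → X) : Prop :=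
  ∃ U V F, IsTimelikeFamily L γ U V F ∧ FamilyContinuousAt L γ U V F

namespace LorentzianPreLengthSpace

section Param


lemma isParam_id : IsParam (fun t : ℝ => t) :=
  ⟨continuousOn_id, fun _ _ _ _ h => h, by simp⟩

lemma _root_.IsParam.mapsTo {φ : ℝ → ℝ} (h : IsParam φ) : MapsTo φ (Icc 0 1) (Icc 0 1) := by
  intro t ht
  rw [← h.2.2]
  exact mem_image_of_mem _ ht

lemma _root_.IsParam.surjOn {φ : ℝ → ℝ} (h : IsParam φ) : SurjOn φ (Icc 0 1) (Icc 0 1) :=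
  h.2.2.ge

/-- A strictly increasing surjection of `[0,1]` onto itself is a parametrization. -/
lemma isParam_of_strictMonoOn {φ : ℝ → ℝ} (hmono : StrictMonoOn φ (Icc 0 1))
    (himg : φ '' Icc 0 1 = Icc 0 1) : IsParam φ := by
  refine ⟨fun t ht => ?_, hmono, himg⟩
  let e := hmono.orderIso φ (Icc 0 1)
  have he : Continuous (fun x : Icc (0:ℝ) 1 => φ x) := by
    have hoc : (φ '' Icc (0:ℝ) 1).OrdConnected := by
      rw [himg]
      exact ordConnected_Icc
    exact continuous_subtype_val.comp e.continuous
  exact (continuousOn_iff_continuous_domRestrict.2 he) t ht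

lemma _root_.IsParam.exists_inverse {φ : ℝ → ℝ} (h : IsParam φ) :
    ∃ ψ : ℝ → ℝ, IsParam ψ ∧ ∀ t ∈ Icc (0:ℝ) 1, φ (ψ t) = t := by
  have hinv : ∀ t ∈ Icc (0:ℝ) 1, Function.invFunOn φ (Icc 0 1) t ∈ Icc (0:ℝ) 1 ∧
      φ (Function.invFunOn φ (Icc 0 1) t) = t := fun t ht =>
    ⟨Function.invFunOn_mem (h.surjOn ht), Function.invFunOn_eq (h.surjOn ht)⟩
  refine ⟨Function.invFunOn φ (Icc 0 1), isParam_of_strictMonoOn ?_ ?_, fun t ht => (hinv t ht).2⟩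
  · intro s hs t ht hst
    rw [← h.2.1.lt_iff_lt (hinv s hs).1 (hinv t ht).1, (hinv s hs).2, (hinv t ht).2]
    exact hst
  · apply Subset.antisymm
    · rintro _ ⟨t, ht, rfl⟩
      exact (hinv t ht).1
    · intro t ht
      refine ⟨φ t, h.mapsTo ht, ?_⟩
      exact h.2.1.injOn (hinv _ (h.mapsTo ht)).1 ht (hinv _ (h.mapsTo ht)).2

lemma _root_.PathEquiv.symm {X : Type*} {γ σ : ℝ → X} (h : PathEquiv γ σ) : PathEquiv σ γ := by
  obtain ⟨φ, hφ, he⟩ := h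
  obtain ⟨ψ, hψ, hi⟩ := hφ.exists_inverse
  exact ⟨ψ, hψ, fun t ht => by rw [he _ (hψ.mapsTo ht), hi t ht]⟩

lemma _root_.PathEquiv.trans {X : Type*} {γ σ ρ : ℝ → X} (h : PathEquiv γ σ) (h' : PathEquiv σ ρ) :
    PathEquiv γ ρ := by
  obtain ⟨φ, hφ, he⟩ := h
  obtain ⟨ψ, hψ, he'⟩ := h'
  refine ⟨ψ ∘ φ, ⟨hψ.1.comp hφ.1 hφ.mapsTo, fun s hs t ht hst =>
    hψ.2.1 (hφ.mapsTo hs) (hφ.mapsTo ht) (hφ.2.1 hs ht hst), ?_⟩, fun t ht => ?_⟩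
  · rw [image_comp, hφ.2.2, hψ.2.2]
  · rw [he t ht, he' _ (hφ.mapsTo ht), Function.comp]

/-- An injective path whose image lies in that of another injective path with the same endpoints
is a reparametrization of it. -/
lemma pathEquiv_of_image_subset {γ σ : ℝ → X} (hγ : ContinuousOn γ (Icc 0 1))
    (hσ : ContinuousOn σ (Icc 0 1)) (hγi : InjOn γ (Icc 0 1)) (hσi : InjOn σ (Icc 0 1))
    (h0 : σ 0 = γ 0) (h1 : σ 1 = γ 1) (himg : ∀ t ∈ Icc (0:ℝ) 1, σ t ∈ γ '' Icc 0 1) :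
    PathEquiv σ γ := by
  set φ : ℝ → ℝ := fun t => Function.invFunOn γ (Icc 0 1) (σ t) with hφ
  have hm : ∀ t ∈ Icc (0:ℝ) 1, φ t ∈ Icc (0:ℝ) 1 ∧ γ (φ t) = σ t := fun t ht =>
    ⟨Function.invFunOn_mem (himg t ht), Function.invFunOn_eq (himg t ht)⟩
  have z : (0:ℝ) ∈ Icc (0:ℝ) 1 := by simp
  have o : (1:ℝ) ∈ Icc (0:ℝ) 1 := by simp
  have hφ0 : φ 0 = 0 := hγi (hm 0 z).1 z ((hm 0 z).2.trans h0)
  have hφ1 : φ 1 = 1 := hγi (hm 1 o).1 o ((hm 1 o).2.trans h1)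
  have hcont : ContinuousOn φ (Icc 0 1) := by
    rw [continuousOn_iff_isClosed]
    intro t ht
    have hc : IsClosed (γ '' (t ∩ Icc 0 1)) :=
      ((isCompact_Icc.inter_left ht).image_of_continuousOn
        (hγ.mono inter_subset_right)).isClosed
    obtain ⟨u, hu, he⟩ := continuousOn_iff_isClosed.1 hσ _ hc
    refine ⟨u, hu, ?_⟩
    rw [← he]
    ext s
    constructor
    · rintro ⟨h, hs⟩
      exact ⟨⟨φ s, ⟨h, (hm s hs).1⟩, (hm s hs).2⟩, hs⟩
    · rintro ⟨⟨v, ⟨hv, hvI⟩, hvs⟩, hs⟩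
      refine ⟨?_, hs⟩
      have : φ s = v := hγi (hm s hs).1 hvI ((hm s hs).2.trans hvs.symm)
      simpa [this] using hv
  have hinj : InjOn φ (Icc 0 1) := by
    intro s hs t ht hst
    apply hσi hs ht
    rw [← (hm s hs).2, ← (hm t ht).2, hst]
  have hmono : StrictMonoOn φ (Icc 0 1) :=
    hcont.strictMonoOn_of_injOn_Icc zero_le_one (by simp [hφ0, hφ1]) hinj
  refine ⟨φ, ⟨hcont, hmono, Subset.antisymm ?_ ?_⟩, fun t ht => (hm t ht).2.symm⟩
  · rintro _ ⟨t, ht, rfl⟩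
    exact (hm t ht).1
  · have := intermediate_value_Icc (zero_le_one (α := ℝ)) hcont
    rwa [hφ0, hφ1] at this

end Param

section Frechet

lemma frechetDist_set_nonempty {γ σ : ℝ → X} (hγ : ContinuousOn γ (Icc 0 1))
    (hσ : ContinuousOn σ (Icc 0 1)) :
    { r : ℝ | ∃ φ ψ : ℝ → ℝ, IsParam φ ∧ IsParam ψ ∧
      ∀ t ∈ Icc (0:ℝ) 1, dist (γ (φ t)) (σ (ψ t)) ≤ r }.Nonempty := by
  obtain ⟨C, hC⟩ := isCompact_Icc.exists_bound_of_continuousOn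
    (continuous_dist.comp_continuousOn (hγ.prodMk hσ))
  exact ⟨C, _, _, isParam_id, isParam_id, fun t ht => (le_abs_self _).trans (hC t ht)⟩

lemma frechetDist_nonneg (γ σ : ℝ → X) : 0 ≤ frechetDist γ σ := by
  apply Real.sInf_nonneg
  rintro r ⟨φ, ψ, -, -, h⟩
  exact dist_nonneg.trans (h 0 (by simp))

lemma dGamma_nonneg (L : LorentzianPreLengthSpace X) (γ σ : ℝ → X) : 0 ≤ dGamma L γ σ :=
  add_nonneg (frechetDist_nonneg γ σ) (abs_nonneg _)

lemma frechetDist_le_dGamma (L : LorentzianPreLengthSpace X) (γ σ : ℝ → X) :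
    frechetDist γ σ ≤ dGamma L γ σ :=
  le_add_of_nonneg_right (abs_nonneg _)

lemma exists_dist_lt_of_frechetDist_lt {γ σ : ℝ → X} (hγ : ContinuousOn γ (Icc 0 1))
    (hσ : ContinuousOn σ (Icc 0 1)) {ε : ℝ} (h : frechetDist γ σ < ε) {u : ℝ}
    (hu : u ∈ Icc (0:ℝ) 1) : ∃ v ∈ Icc (0:ℝ) 1, dist (γ u) (σ v) < ε := by
  obtain ⟨r, ⟨φ, ψ, hφ, hψ, hr⟩, hrε⟩ :=
    exists_lt_of_csInf_lt (frechetDist_set_nonempty hγ hσ) h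
  obtain ⟨t, ht, rfl⟩ := hφ.surjOn hu
  exact ⟨ψ t, hψ.mapsTo ht, (hr t ht).trans_lt hrε⟩

lemma frechetDist_le_add {γ γ' σ : ℝ → X} (hγ : ContinuousOn γ (Icc 0 1))
    (hσ : ContinuousOn σ (Icc 0 1)) {c : ℝ} (h : ∀ t ∈ Icc (0:ℝ) 1, dist (γ' t) (γ t) ≤ c) :
    frechetDist γ' σ ≤ c + frechetDist γ σ := by
  rw [← sub_le_iff_le_add']
  apply le_csInf (frechetDist_set_nonempty hγ hσ)
  rintro r ⟨φ, ψ, hφ, hψ, hr⟩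
  rw [sub_le_iff_le_add']
  refine csInf_le ⟨0, ?_⟩ ⟨φ, ψ, hφ, hψ, fun t ht => ?_⟩
  · rintro r ⟨φ, ψ, -, -, h⟩
    exact dist_nonneg.trans (h 0 (by simp))
  · exact (dist_triangle _ _ _).trans (add_le_add (h _ (hφ.mapsTo ht)) (hr t ht))

end Frechet

section TauLength

variable (L : LorentzianPreLengthSpace X)

lemma tauLength_le_tau (γ : ℝ → X) {a b : ℝ} (hab : a < b) :
    tauLength L γ a b ≤ L.tau (γ a) (γ b) := by
  refine sInf_le ⟨1, fun i => if i = 0 then a else b, le_rfl, by simp, by simp, ?_, by simp⟩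
  intro i hi j hj hij
  simp only [mem_Iic] at hi hj
  obtain rfl : i = 0 := by omega
  obtain rfl : j = 1 := by omega
  simpa using hab

lemma tauLength_le_tau_add (γ : ℝ → X) {a b c : ℝ} (hab : a < b) :
    tauLength L γ a c ≤ L.tau (γ a) (γ b) + tauLength L γ b c := by
  unfold tauLength
  rw [ENNReal.add_sInf]
  refine le_iInf₂ ?_
  rintro _ ⟨N, t, hN, h0, h1, hmono, rfl⟩
  refine sInf_le ⟨N + 1, fun i => if i = 0 then a else t (i - 1), by omega, by simp, by simp [h1],
    ?_, ?_⟩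
  · intro i hi j hj hij
    simp only [mem_Iic] at hi hj
    have hj0 : j ≠ 0 := by omega
    simp only [hj0, if_false]
    have hb : b ≤ t (j - 1) := by
      rw [← h0]
      exact hmono.monotoneOn (by simp) (by simp; omega) (by omega)
    split_ifs with hi0
    · exact hab.trans_le hb
    · exact hmono (by simp; omega) (by simp; omega) (by omega)
  · rw [Finset.sum_range_succ']
    simp [h0, add_comm]

lemma tauLength_mono_left {γ : ℝ → X} {a b c : ℝ} (hab : a ≤ b) (hbc : b < c)
    (hγ : ∀ s t : ℝ, a ≤ s → s < t → t ≤ c → L.causal (γ s) (γ t)) :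
    tauLength L γ b c ≤ tauLength L γ a c := by
  apply le_sInf
  rintro _ ⟨N, t, hN, h0, h1, hmono, rfl⟩
  classical
  have hex : ∃ k, b < t k := ⟨N, by rwa [h1]⟩
  obtain ⟨k, hk⟩ : ∃ k, Nat.find hex = k + 1 := by
    refine Nat.exists_eq_succ_of_ne_zero fun h => ?_
    have := Nat.find_spec hex
    rw [h, h0] at this
    linarith
  have hk1 : b < t (k + 1) := hk ▸ Nat.find_spec hex
  have hk0 : t k ≤ b := not_lt.1 (Nat.find_min hex (m := k) (by omega))
  have hkN : k + 1 ≤ N := hk ▸ Nat.find_min' hex (by rwa [h1])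
  have hbig : ∀ i, k + 1 ≤ i → i ≤ N → b < t i := fun i hi hiN =>
    hk1.trans_le (hmono.monotoneOn hkN hiN hi)
  have hlow : ∀ i, i ≤ N → a ≤ t i := fun i hi => by
    rw [← h0]; exact hmono.monotoneOn (by simp) hi (by omega)
  have hup : ∀ i, i ≤ N → t i ≤ c := fun i hi => by
    rw [← h1]; exact hmono.monotoneOn hi (by simp) (by omega)
  calc tauLength L γ b c
      ≤ ∑ i ∈ Finset.range (N - k),
          L.tau (γ (max b (t (k + i)))) (γ (max b (t (k + (i + 1))))) := by
        refine sInf_le ⟨N - k, fun i => max b (t (k + i)), by omega, by simp [hk0], ?_, ?_, rfl⟩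
        · simp only [show k + (N - k) = N by omega, h1]
          exact max_eq_right hbc.le
        · intro i hi j hj hij
          simp only [mem_Iic] at hi hj
          have hj' := hbig (k + j) (by omega) (by omega)
          have hij' : t (k + i) < t (k + j) :=
            hmono (by simp; omega) (by simp; omega) (by omega)
          exact (max_lt hj' hij').trans_le (le_max_right _ _)
    _ ≤ ∑ i ∈ Finset.range (N - k), L.tau (γ (t (k + i))) (γ (t (k + i + 1))) := by
        refine Finset.sum_le_sum fun i hi => ?_
        rw [Finset.mem_range] at hi
        have hb' := hbig (k + i + 1) (by omega) (by omega)
        rw [← add_assoc, max_eq_right hb'.le]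
        rcases le_or_gt b (t (k + i)) with h | h
        · rw [max_eq_right h]
        · rw [max_eq_left h.le]
          have := L.rev_triangle (γ (t (k + i))) (γ b) (γ (t (k + i + 1)))
            (hγ _ _ (hlow _ (by omega)) h hbc.le) (hγ _ _ hab hb' (hup _ (by omega)))
          exact le_add_self.trans this
    _ ≤ ∑ i ∈ Finset.range N, L.tau (γ (t i)) (γ (t (i + 1))) := by
        rw [← Nat.add_sub_of_le (show k ≤ N by omega), Finset.sum_range_add]
        simp only [Nat.add_sub_cancel_left]
        exact le_add_self

lemma tauLength_le_comp (γ : ℝ → X) {f : ℝ → ℝ} (hf : StrictMono f) (a b : ℝ) :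
    tauLength L γ (f a) (f b) ≤ tauLength L (fun u => γ (f u)) a b := by
  apply le_sInf
  rintro _ ⟨N, t, hN, h0, h1, hmono, rfl⟩
  exact sInf_le ⟨N, fun i => f (t i), hN, by simp [h0], by simp [h1],
    hf.comp_strictMonoOn hmono, rfl⟩

end TauLength

section Tail

/-- The restriction of `γ` to `[t,1]`, affinely reparametrized on `[0,1]`. -/
def tail (γ : ℝ → X) (t : ℝ) : ℝ → X := fun u => γ (t + (1 - t) * u)

variable {L : LorentzianPreLengthSpace X} {γ : ℝ → X}

lemma tauLength_tail {t : ℝ} (ht : t < 1) (a b : ℝ) :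
    tauLength L (tail γ t) a b = tauLength L γ (t + (1 - t) * a) (t + (1 - t) * b) := by
  have h : 0 < 1 - t := by linarith
  apply le_antisymm
  · have hg : StrictMono (fun s : ℝ => (s - t) / (1 - t)) := fun x y hxy => by
      simp only
      gcongr
    have := tauLength_le_comp L (tail γ t) hg (t + (1 - t) * a) (t + (1 - t) * b)
    have e : ∀ s, (t + (1 - t) * s - t) / (1 - t) = s := fun s => by field_simp; ring
    have e' : (fun u => tail γ t ((u - t) / (1 - t))) = γ := by
      funext u
      simp only [tail]
      congr 1
      field_simp
      ring
    rwa [e', e, e] at this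
  · exact tauLength_le_comp L γ (f := fun u => t + (1 - t) * u)
      (fun x y hxy => by simp only; gcongr) a b

lemma _root_.IsCausalCurveOn.mono {a b a' b' : ℝ} (h : IsCausalCurveOn L γ a b) (ha : a ≤ a')
    (hb : b' ≤ b) : IsCausalCurveOn L γ a' b' := by
  obtain ⟨⟨K, hK⟩, h2, h3⟩ := h
  exact ⟨⟨K, hK.mono (Icc_subset_Icc ha hb)⟩,
    fun s t hs hst ht => h2 s t (ha.trans hs) hst (ht.trans hb),
    fun s t hs hst ht => h3 s t (ha.trans hs) hst (ht.trans hb)⟩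

lemma isMaximizerOn_right {a b c : ℝ} (h : IsMaximizerOn L γ a c)
    (hγ : ∀ s t : ℝ, a ≤ s → s < t → t ≤ c → L.causal (γ s) (γ t))
    (hfin : tauLength L γ a c < ⊤) (hab : a ≤ b) (hbc : b < c) : IsMaximizerOn L γ b c := by
  rcases hab.eq_or_lt with rfl | hab
  · exact h
  refine le_antisymm (tauLength_le_tau L γ hbc) ?_
  have h1 := L.rev_triangle _ _ _ (hγ a b le_rfl hab hbc.le) (hγ b c hab.le hbc le_rfl)
  rw [← h] at h1
  have h2 := h1.trans (tauLength_le_tau_add L γ (c := c) hab)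
  exact (ENNReal.add_le_add_iff_left
    ((le_self_add.trans h1).trans_lt hfin).ne).1 h2

lemma _root_.InTGeo.continuousOn (hγ : InTGeo L γ) : ContinuousOn γ (Icc 0 1) := by
  obtain ⟨⟨⟨K, hK⟩, -⟩, -⟩ := hγ
  exact hK.continuousOn

lemma _root_.InTGeo.tendsto_nhdsGT (hγ : InTGeo L γ) : Tendsto γ (𝓝[>] 0) (𝓝 (γ 0)) := by
  refine Tendsto.mono_left (hγ.continuousOn 0 (by simp)) ?_
  rw [← nhdsWithin_Ioo_eq_nhdsGT (zero_lt_one (α := ℝ))]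
  exact nhdsWithin_mono _ Ioo_subset_Icc_self

/-- In a finitely `τ`-measurable space, timelike geodesics are injective. -/
lemma _root_.InTGeo.injOn (hγ : InTGeo L γ) (hfin : FinitelyTauMeasurable L) :
    InjOn γ (Icc 0 1) := by
  have key : ∀ s t : ℝ, 0 ≤ s → s < t → t ≤ 1 → γ s ≠ γ t := by
    intro s t hs hst ht he
    have hc := (L.chron_iff_pos _ _).1 (hγ.1.2.2 s t hs hst ht)
    rw [← he] at hc
    have htop : L.tau (γ s) (γ s) = ⊤ := by
      by_contra hne
      have := L.rev_triangle (γ s) (γ s) (γ s) (L.causal_refl _) (L.causal_refl _)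
      exact (ENNReal.lt_add_right hne hc.ne').not_ge this
    refine (hfin γ s 1 (hst.trans_le ht) (hγ.2.1.mono hs le_rfl)).not_ge ?_
    apply le_sInf
    rintro _ ⟨N, u, hN, h0, h1, hmono, rfl⟩
    have h01 : u 0 < u 1 := hmono (by simp) hN one_pos
    have hu1 : u 1 ≤ 1 := by
      rw [← h1]
      exact hmono.monotoneOn hN (by simp) hN
    have hcu := hγ.2.1.2.2 (u 0) (u 1) (h0 ▸ hs) h01 hu1
    have hle := L.rev_triangle (γ (u 0)) (γ (u 0)) (γ (u 1)) (L.causal_refl _) hcu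
    rw [h0, htop, top_add] at hle
    refine hle.trans ?_
    rw [← h0]
    exact Finset.single_le_sum (f := fun i => L.tau (γ (u i)) (γ (u (i + 1))))
      (fun _ _ => zero_le) (Finset.mem_range.2 (by omega : 0 < N))
  intro s hs t ht he
  by_contra hne
  rcases lt_or_gt_of_ne hne with h | h
  · exact key s t hs.1 h ht.2 he
  · exact key t s ht.1 h hs.2 he.symm

/-- The time separation along a timelike geodesic is continuous at the starting point. -/
lemma _root_.InTGeo.tendsto_tau (hγ : InTGeo L γ) (hfin : FinitelyTauMeasurable L) :
    Tendsto (fun t => (L.tau (γ 0) (γ t)).toReal) (𝓝[>] 0) (𝓝 0) := by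
  obtain ⟨a, b, ha, ha0, h0b, hb1, -, hb, hmax⟩ := hγ.2.2 0 le_rfl zero_le_one
  obtain rfl : a = 0 := le_antisymm ha0 ha
  have hb : 0 < b := hb.resolve_right zero_ne_one
  have hTfin : L.tau (γ 0) (γ b) ≠ ⊤ := by
    rw [← hmax]
    exact (hfin γ 0 b hb (hγ.2.1.mono le_rfl hb1)).ne
  rw [← ENNReal.toReal_zero]
  refine (ENNReal.tendsto_toReal ENNReal.zero_ne_top).comp ?_
  rw [ENNReal.tendsto_nhds_zero]
  intro ε hε
  have hT : L.tau (γ 0) (γ b) ≠ 0 := ((L.chron_iff_pos _ _).1 (hγ.1.2.2 0 b le_rfl hb hb1)).ne'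
  have hlsc := L.tau_lsc (γ 0, γ b) (L.tau (γ 0) (γ b) - ε) (ENNReal.sub_lt_self hTfin hT hε.ne')
  have hcont : Tendsto (fun t => (γ t, γ b)) (𝓝[>] 0) (𝓝 (γ 0, γ b)) :=
    hγ.tendsto_nhdsGT.prodMk_nhds tendsto_const_nhds
  filter_upwards [hcont.eventually hlsc, Ioo_mem_nhdsGT hb] with t ht htb
  have hrev := L.rev_triangle _ _ _ (hγ.2.1.2.2 0 t le_rfl htb.1 (htb.2.le.trans hb1))
    (hγ.2.1.2.2 t b htb.1.le htb.2 hb1)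
  have h2 : L.tau (γ 0) (γ b) ≤ L.tau (γ t) (γ b) + ε := tsub_le_iff_right.1 ht.le
  have hf : L.tau (γ t) (γ b) ≠ ⊤ := ((le_add_self.trans hrev).trans_lt hTfin.lt_top).ne
  have h3 := hrev.trans h2
  rw [add_comm] at h3
  exact (ENNReal.add_le_add_iff_left hf).1 h3

lemma _root_.InTGeo.tail (hγ : InTGeo L γ) (hfin : FinitelyTauMeasurable L) {t : ℝ} (h0 : 0 ≤ t)
    (h1 : t < 1) : InTGeo L (tail γ t) := by
  have hpos : 0 < 1 - t := by linarith
  obtain ⟨⟨⟨K, hK⟩, hnc, hch⟩, hc, hgeo⟩ := hγ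
  have hin : ∀ u : ℝ, 0 ≤ u → 0 ≤ t + (1 - t) * u := fun u hu => by positivity
  have hout : ∀ u : ℝ, u ≤ 1 → t + (1 - t) * u ≤ 1 := fun u hu => by nlinarith
  have hlt : ∀ u v : ℝ, u < v → t + (1 - t) * u < t + (1 - t) * v := fun u v h => by gcongr
  have hinv : ∀ s, t + (1 - t) * ((s - t) / (1 - t)) = s := fun s => by field_simp; ring
  have hlip : ∃ K : ℝ≥0, LipschitzOnWith K (LorentzianPreLengthSpace.tail γ t) (Icc 0 1) := by
    refine ⟨K, LipschitzOnWith.of_dist_le_mul fun u hu v hv => ?_⟩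
    refine (hK.dist_le_mul _ ⟨hin u hu.1, hout u hu.2⟩ _ ⟨hin v hv.1, hout v hv.2⟩).trans ?_
    gcongr
    rw [Real.dist_eq, Real.dist_eq, show t + (1 - t) * u - (t + (1 - t) * v) = (1 - t) * (u - v)
      by ring, abs_mul, abs_of_pos hpos]
    exact mul_le_of_le_one_left (abs_nonneg _) (by linarith)
  have hnc' : NowhereConstantOn (LorentzianPreLengthSpace.tail γ t) 0 1 := by
    intro s s' hs hss hs'
    obtain ⟨u, hu1, hu2, hu⟩ := hnc _ _ (hin s hs) (hlt s s' hss) (hout s' hs')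
    refine ⟨(u - t) / (1 - t), ?_, ?_, ?_⟩
    · rw [le_div_iff₀ hpos]; linarith
    · rw [div_le_iff₀ hpos]; linarith
    · simpa only [LorentzianPreLengthSpace.tail, hinv] using hu
  refine ⟨⟨hlip, hnc', fun u v hu huv hv => hch _ _ (hin u hu) (hlt u v huv) (hout v hv)⟩,
    ⟨hlip, hnc', fun u v hu huv hv => hc.2.2 _ _ (hin u hu) (hlt u v huv) (hout v hv)⟩, ?_⟩
  intro u hu0 hu1
  obtain ⟨a, b, ha, hau, hub, hb, hal, hbr, hmax⟩ := hgeo _ (hin u hu0) (hout u hu1)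
  have htu : t ≤ t + (1 - t) * u := by nlinarith
  have hmb : max a t < b := by
    rcases hbr with h | h
    · exact max_lt (hau.trans_lt h) (htu.trans_lt h)
    · have : b = 1 := le_antisymm hb (h ▸ hub)
      refine max_lt ?_ (this ▸ h1)
      rcases hal with h' | h'
      · exact h'.trans_le hub
      · linarith
  refine ⟨(max a t - t) / (1 - t), (b - t) / (1 - t), ?_, ?_, ?_, ?_, ?_, ?_, ?_⟩
  · exact div_nonneg (by simp) hpos.le
  · rw [div_le_iff₀ hpos]
    linarith [max_le hau htu]
  · rw [le_div_iff₀ hpos]; linarith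
  · rw [div_le_iff₀ hpos]; linarith
  · rcases hu0.eq_or_lt with h | h
    · exact Or.inr h.symm
    · left
      rw [div_lt_iff₀ hpos]
      have : max a t < t + (1 - t) * u := by
        refine max_lt ?_ (by nlinarith)
        rcases hal with h' | h'
        · exact h'
        · nlinarith
      linarith
  · rcases hbr with h | h
    · left
      rw [lt_div_iff₀ hpos]; linarith
    · right
      nlinarith
  · have hcab : ∀ s t : ℝ, a ≤ s → s < t → t ≤ b → L.causal (γ s) (γ t) :=
      fun s t hs hst ht => hc.2.2 s t (ha.trans hs) hst (ht.trans hb)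
    have hab : a < b := (le_max_left _ _).trans_lt hmb
    have := isMaximizerOn_right hmax hcab (hfin γ a b hab (hc.mono ha hb)) (le_max_left a t) hmb
    unfold IsMaximizerOn at this ⊢
    rw [tauLength_tail h1]
    simpa only [LorentzianPreLengthSpace.tail, hinv] using this

/-- The distance `d_Γ` between the tails of a timelike geodesic and `σ` is asymptotically at most
that of the whole geodesic. -/
lemma eventually_dGamma_tail_lt (hγ : InTGeo L γ) (hfin : FinitelyTauMeasurable L) {σ : ℝ → X}
    (hσ : ContinuousOn σ (Icc 0 1)) {ε : ℝ} (h : dGamma L γ σ < ε) :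
    ∀ᶠ t in 𝓝[>] 0, dGamma L (tail γ t) σ < ε := by
  obtain ⟨K, hK⟩ := hγ.1.1
  have hlim : Tendsto (fun t : ℝ => K * t + (L.tau (γ 0) (γ t)).toReal + dGamma L γ σ) (𝓝[>] 0)
      (𝓝 (K * 0 + 0 + dGamma L γ σ)) := by
    refine Tendsto.add_const _ (Tendsto.add ?_ (hγ.tendsto_tau hfin))
    exact (tendsto_nhdsWithin_of_tendsto_nhds tendsto_id).const_mul _
  have hlt : (K : ℝ) * 0 + 0 + dGamma L γ σ < ε := by simpa using h
  have htau : ∀ᶠ t in 𝓝[>] (0:ℝ), L.tau (γ 0) (γ t) ≠ ⊤ := by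
    obtain ⟨a, b, ha, ha0, h0b, hb1, -, hb, hmax⟩ := hγ.2.2 0 le_rfl zero_le_one
    obtain rfl : a = 0 := le_antisymm ha0 ha
    have hb : 0 < b := hb.resolve_right zero_ne_one
    filter_upwards [Ioo_mem_nhdsGT hb] with t ht
    have hrev := L.rev_triangle _ _ _ (hγ.2.1.2.2 0 t le_rfl ht.1 (ht.2.le.trans hb1))
      (hγ.2.1.2.2 t b ht.1.le ht.2 hb1)
    rw [← hmax] at hrev
    exact ((le_self_add.trans hrev).trans_lt (hfin γ 0 b hb (hγ.2.1.mono le_rfl hb1))).ne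
  filter_upwards [hlim.eventually_lt_const hlt, Ioo_mem_nhdsGT one_pos, htau] with t ht ht1 htt
  refine lt_of_le_of_lt ?_ ht
  have hfr : frechetDist (tail γ t) σ ≤ K * t + frechetDist γ σ := by
    refine frechetDist_le_add hγ.continuousOn hσ fun u hu => ?_
    have hpos : 0 < 1 - t := by linarith [ht1.2]
    have hmem : t + (1 - t) * u ∈ Icc (0:ℝ) 1 :=
      ⟨add_nonneg ht1.1.le (mul_nonneg hpos.le hu.1), by nlinarith [hu.2]⟩
    refine (hK.dist_le_mul _ hmem _ hu).trans ?_
    gcongr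
    rw [Real.dist_eq, show t + (1 - t) * u - u = t * (1 - u) by ring,
      abs_of_nonneg (mul_nonneg ht1.1.le (by linarith [hu.2]))]
    exact mul_le_of_le_one_right ht1.1.le (by linarith [hu.1])
  have hl : tauLength L (tail γ t) 0 1 = tauLength L γ t 1 := by
    rw [tauLength_tail ht1.2]
    simp
  have hL1 : tauLength L γ t 1 ≠ ⊤ := (hfin γ t 1 ht1.2 (hγ.2.1.mono ht1.1.le le_rfl)).ne
  have hL0 : tauLength L γ 0 1 ≠ ⊤ := (hfin γ 0 1 one_pos hγ.2.1).ne
  have hle1 : (tauLength L γ t 1).toReal ≤ (tauLength L γ 0 1).toReal :=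
    ENNReal.toReal_mono hL0 (tauLength_mono_left L ht1.1.le ht1.2 hγ.2.1.2.2)
  have hle2 : (tauLength L γ 0 1).toReal ≤
      (L.tau (γ 0) (γ t)).toReal + (tauLength L γ t 1).toReal := by
    rw [← ENNReal.toReal_add htt hL1]
    exact ENNReal.toReal_mono (ENNReal.add_ne_top.2 ⟨htt, hL1⟩)
      (tauLength_le_tau_add L γ ht1.1)
  have habs : |(tauLength L γ t 1).toReal - (tauLength L σ 0 1).toReal| ≤
      (L.tau (γ 0) (γ t)).toReal +
        |(tauLength L γ 0 1).toReal - (tauLength L σ 0 1).toReal| := by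
    refine (abs_sub_le _ (tauLength L γ 0 1).toReal _).trans ?_
    gcongr
    rw [abs_le]
    constructor <;> linarith
  unfold dGamma
  rw [hl]
  linarith

end Tail

section Family

variable {L : LorentzianPreLengthSpace X} {γ : ℝ → X} {U V : Set X} {F : X → X → ℝ → X}

/-- If a timelike geodesic `ρ` with the endpoints of `γ` is not equivalent to `γ`, then there are
arbitrarily short initial pieces of `ρ` whose removal leaves a geodesic not belonging to the given
family. -/
lemma frequently_not_pathEquiv_tail (hfin : FinitelyTauMeasurable L) (hγ : InTGeo L γ)
    (hF : IsTimelikeFamily L γ U V F) (hFc : FamilyContinuousAt L γ U V F) {ρ : ℝ → X}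
    (hρ : InTGeo L ρ) (h0 : ρ 0 = γ 0) (h1 : ρ 1 = γ 1) (hne : ¬ PathEquiv ρ γ) :
    ∃ᶠ t in 𝓝[>] 0, ¬ PathEquiv (F (ρ t) (γ 1)) (tail ρ t) := by
  intro hev
  simp only [not_not] at hev
  apply hne
  have hclosed : IsClosed (γ '' Icc 0 1) :=
    (isCompact_Icc.image_of_continuousOn hγ.continuousOn).isClosed
  have hcont : Tendsto ρ (𝓝[>] 0) (𝓝 (γ 0)) := by
    rw [← h0]
    exact hρ.tendsto_nhdsGT
  refine pathEquiv_of_image_subset hγ.continuousOn hρ.continuousOn (hγ.injOn hfin)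
    (hρ.injOn hfin) h0 h1 fun u hu => ?_
  rcases hu.1.eq_or_lt with rfl | hu0
  · exact ⟨0, by simp, h0.symm⟩
  rw [← hclosed.closure_eq, Metric.mem_closure_iff]
  intro ε hε
  obtain ⟨δ, hδ, hd⟩ := hFc ε hε
  have hV : γ 1 ∈ V := mem_of_mem_nhds hF.2.1
  obtain ⟨t, hpe, hB, hU, ht0, htu⟩ :=
    (hev.and ((hcont.eventually (Metric.ball_mem_nhds _ hδ)).and ((hcont.eventually hF.1).and
      (Ioc_mem_nhdsGT (lt_min hu0 (half_pos (zero_lt_one (α := ℝ)))))))).exists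
  have hpos : 0 < 1 - t := by linarith [htu.trans (min_le_right _ _)]
  have htu' := htu.trans (min_le_left _ _)
  have hclose := hd _ hU _ hV hB (by simpa using hδ)
  obtain ⟨ψ, hψ, he⟩ := hpe.symm
  have hmem : (u - t) / (1 - t) ∈ Icc (0:ℝ) 1 :=
    ⟨div_nonneg (by linarith) hpos.le, by rw [div_le_one hpos]; linarith [hu.2]⟩
  have hval := he _ hmem
  have : tail ρ t ((u - t) / (1 - t)) = ρ u := by
    simp only [tail]
    congr 1
    field_simp
    ring
  obtain ⟨v, hv, hdv⟩ := exists_dist_lt_of_frechetDist_lt (hF.2.2.2.1 _ hU _ hV).1.continuousOn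
    hγ.continuousOn ((frechetDist_le_dGamma L _ _).trans_lt hclose) (hψ.mapsTo hmem)
  refine ⟨γ v, mem_image_of_mem _ hv, ?_⟩
  rwa [← this, hval]

/-- If the endpoints of `γ` are symmetrically conjugate, then arbitrarily close to `γ` there are
timelike geodesics not belonging to the given family and not having both endpoints in common
with `γ`. -/
lemma exists_not_pathEquiv_of_symmConjugate (hfin : FinitelyTauMeasurable L) (hγ : InTGeo L γ)
    (hF : IsTimelikeFamily L γ U V F) (hFc : FamilyContinuousAt L γ U V F)
    (hconj : SymmConjugate L γ (γ 0) (γ 1)) {ε : ℝ} (hε : 0 < ε) :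
    ∃ z : X × X, z ≠ (γ 0, γ 1) ∧ dist z (γ 0, γ 1) < ε ∧ ∃ ρ, InTGeo L ρ ∧ ρ 0 = z.1 ∧
      ρ 1 = z.2 ∧ ¬ PathEquiv (F z.1 z.2) ρ ∧ dGamma L ρ γ < ε := by
  obtain ⟨ps, qs, γs, σs, hps, hqs, hall, hγs, hσs⟩ := hconj
  obtain ⟨i, hz, h1, h2⟩ := (((hps.prodMk_nhds hqs).eventually (Metric.ball_mem_nhds _ hε)).and
    ((hγs.eventually_lt_const hε).and (hσs.eventually_lt_const hε))).exists
  obtain ⟨hgi, hsi, hg0, hg1, hs0, hs1, hns⟩ := hall i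
  obtain ⟨ρ, hρ, hρ0, hρ1, hne, hd⟩ : ∃ ρ, InTGeo L ρ ∧ ρ 0 = ps i ∧ ρ 1 = qs i ∧
      ¬ PathEquiv (F (ps i) (qs i)) ρ ∧ dGamma L ρ γ < ε := by
    by_cases h : PathEquiv (F (ps i) (qs i)) (γs i)
    · exact ⟨σs i, hsi, hs0, hs1, fun h' => hns (h.symm.trans h'), h2⟩
    · exact ⟨γs i, hgi, hg0, hg1, h, h1⟩
  by_cases heq : (ps i, qs i) = (γ 0, γ 1)
  · obtain ⟨hp, hq⟩ := Prod.mk.injEq .. ▸ heq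
    rw [hp, hq] at hne
    rw [hp] at hρ0
    rw [hq] at hρ1
    have hne' : ¬ PathEquiv ρ γ := fun h => hne (hF.2.2.2.2.trans h.symm)
    have hcont : Tendsto ρ (𝓝[>] 0) (𝓝 (γ 0)) := by
      rw [← hρ0]
      exact hρ.tendsto_nhdsGT
    obtain ⟨t, hnt, hdt, hB, ht0, ht1⟩ :=
      ((frequently_not_pathEquiv_tail hfin hγ hF hFc hρ hρ0 hρ1 hne').and_eventually
        ((eventually_dGamma_tail_lt hρ hfin hγ.continuousOn hd).and
          ((hcont.eventually (Metric.ball_mem_nhds _ hε)).and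
            (Ioo_mem_nhdsGT one_pos)))).exists
    refine ⟨(ρ t, γ 1), fun h => ?_, ?_, tail ρ t, hρ.tail hfin ht0.le ht1, ?_, ?_, hnt, hdt⟩
    · have h' : ρ t = ρ 0 := (Prod.mk.inj h).1.trans hρ0.symm
      exact ht0.ne' (hρ.injOn hfin ⟨ht0.le, ht1.le⟩ (by simp) h')
    · rw [Prod.dist_eq]
      simpa [hε] using hB
    · simp [tail]
    · simpa [tail] using hρ1
  · exact ⟨(ps i, qs i), heq, hz, ρ, hρ, hρ0, hρ1, hne, hd⟩

end Family

end LorentzianPreLengthSpace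

/-- Suppose there exists a timelike family `F` about `γ ∈ TGeo(X)`
continuous at `γ`. Then the endpoints of `γ` are not symmetrically conjugate along `γ`
if and only if `F` represents the unique germ of timelike families continuous at `γ`. -/
theorem not_symmConjugate_iff_unique_germ
    {X : Type*} [MetricSpace X] (L : LorentzianPreLengthSpace X)
    (hfin : FinitelyTauMeasurable L)
    (γ : ℝ → X) (hγ : InTGeo L γ) (p q : X) (hp : γ 0 = p) (hq : γ 1 = q)
    (U V : Set X) (F : X → X → ℝ → X)
    (hF : IsTimelikeFamily L γ U V F) (hFc : FamilyContinuousAt L γ U V F) :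
    (¬ SymmConjugate L γ p q) ↔
      (∀ (U' V' : Set X) (F' : X → X → ℝ → X),
        IsTimelikeFamily L γ U' V' F' → FamilyContinuousAt L γ U' V' F' →
        FamiliesAgreeNear p q U V U' V' F F') := by
  classical
  subst hp hq
  constructor
  · intro hnc U' V' F' hF' hFc'
    by_contra hag
    apply hnc
    have hbad : ∀ n : ℕ, ∃ x y, x ∈ U ∩ U' ∧ y ∈ V ∩ V' ∧ dist x (γ 0) < 1 / ((n : ℝ) + 1) ∧
        dist y (γ 1) < 1 / ((n : ℝ) + 1) ∧ ¬ PathEquiv (F x y) (F' x y) := by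
      intro n
      by_contra hcon
      push Not at hcon
      have hn : 0 < 1 / ((n : ℝ) + 1) := Nat.one_div_pos_of_nat
      exact hag ⟨(U ∩ U') ∩ Metric.ball (γ 0) (1 / ((n : ℝ) + 1)),
        inter_mem (inter_mem hF.1 hF'.1) (Metric.ball_mem_nhds _ hn),
        (V ∩ V') ∩ Metric.ball (γ 1) (1 / ((n : ℝ) + 1)),
        inter_mem (inter_mem hF.2.1 hF'.2.1) (Metric.ball_mem_nhds _ hn),
        inter_subset_left, inter_subset_left,
        fun x hx y hy => hcon x y hx.1 hy.1 hx.2 hy.2⟩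
    choose x y hx hy hdx hdy hne using hbad
    have hlim := tendsto_one_div_add_atTop_nhds_zero_nat (𝕜 := ℝ)
    have hconv : ∀ (U V : Set X) (F : X → X → ℝ → X), FamilyContinuousAt L γ U V F →
        (∀ n, x n ∈ U) → (∀ n, y n ∈ V) → DGammaTendsto L (fun n => F (x n) (y n)) γ := by
      intro U V F hFc hxU hyV
      refine tendsto_order.2 ⟨fun a ha => Eventually.of_forall fun n =>
        ha.trans_le (LorentzianPreLengthSpace.dGamma_nonneg L _ _), fun ε hε => ?_⟩
      obtain ⟨δ, hδ, hd⟩ := hFc ε hε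
      filter_upwards [hlim.eventually_lt_const hδ] with n hn
      exact hd _ (hxU n) _ (hyV n) ((hdx n).trans hn) ((hdy n).trans hn)
    refine ⟨x, y, fun n => F (x n) (y n), fun n => F' (x n) (y n), ?_, ?_, fun n => ?_,
      hconv U V F hFc (fun n => (hx n).1) (fun n => (hy n).1),
      hconv U' V' F' hFc' (fun n => (hx n).2) (fun n => (hy n).2)⟩
    · exact tendsto_iff_dist_tendsto_zero.2
        (squeeze_zero (fun _ => dist_nonneg) (fun n => (hdx n).le) hlim)
    · exact tendsto_iff_dist_tendsto_zero.2
        (squeeze_zero (fun _ => dist_nonneg) (fun n => (hdy n).le) hlim)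
    · obtain ⟨h1, h2, h3⟩ := hF.2.2.2.1 _ (hx n).1 _ (hy n).1
      obtain ⟨h1', h2', h3'⟩ := hF'.2.2.2.1 _ (hx n).2 _ (hy n).2
      exact ⟨h1, h1', h2, h3, h2', h3', hne n⟩
  · intro huniq hconj
    choose z hz hzd ρ hρ hρ0 hρ1 hne hd using fun n : ℕ =>
      LorentzianPreLengthSpace.exists_not_pathEquiv_of_symmConjugate hfin hγ hF hFc hconj
        (Nat.one_div_pos_of_nat (α := ℝ) (n := n))
    have hlim := tendsto_one_div_add_atTop_nhds_zero_nat (𝕜 := ℝ)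
    let F' : X → X → ℝ → X := fun x y =>
      if h : ∃ n, z n = (x, y) then ρ h.choose else F x y
    have hF'pos : ∀ x y, (∃ n, z n = (x, y)) → ∃ n, z n = (x, y) ∧ F' x y = ρ n :=
      fun x y h => ⟨h.choose, h.choose_spec, dif_pos h⟩
    have hF'neg : ∀ x y, (¬ ∃ n, z n = (x, y)) → F' x y = F x y := fun x y h => dif_neg h
    have hfam : IsTimelikeFamily L γ U V F' := by
      refine ⟨hF.1, hF.2.1, hF.2.2.1, fun x hx y hy => ?_, ?_⟩
      · by_cases h : ∃ n, z n = (x, y)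
        · obtain ⟨n, hn, he⟩ := hF'pos x y h
          rw [he, hρ0, hρ1, hn]
          exact ⟨hρ n, rfl, rfl⟩
        · rw [hF'neg x y h]
          exact hF.2.2.2.1 x hx y hy
      · rw [hF'neg _ _ fun ⟨n, hn⟩ => hz n hn]
        exact hF.2.2.2.2
    have hcont : FamilyContinuousAt L γ U V F' := by
      intro ε hε
      obtain ⟨δ, hδ, hdF⟩ := hFc ε hε
      obtain ⟨N, hN⟩ := eventually_atTop.1 (hlim.eventually_lt_const hε)
      have hfinite : (z '' Iio N).Finite := (finite_Iio N).image z
      obtain ⟨η, hη, hball⟩ := Metric.mem_nhds_iff.1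
        (hfinite.isClosed.isOpen_compl.mem_nhds (x := (γ 0, γ 1)) (by
          rintro ⟨n, -, hn⟩
          exact hz n hn))
      refine ⟨min δ η, lt_min hδ hη, fun x hx y hy hxd hyd => ?_⟩
      by_cases h : ∃ n, z n = (x, y)
      · obtain ⟨n, hn, he⟩ := hF'pos x y h
        rw [he]
        rcases lt_or_ge n N with hnN | hnN
        · have hmem : (x, y) ∈ Metric.ball (γ 0, γ 1) η := by
            rw [Metric.mem_ball, Prod.dist_eq]
            exact max_lt (hxd.trans_le (min_le_right _ _)) (hyd.trans_le (min_le_right _ _))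
          exact absurd ⟨n, hnN, hn⟩ (hball hmem)
        · exact (hd n).trans (hN n hnN)
      · rw [hF'neg x y h]
        exact hdF x hx y hy (hxd.trans_le (min_le_left _ _)) (hyd.trans_le (min_le_left _ _))
    obtain ⟨U'', hU'', V'', hV'', -, -, hag⟩ := huniq U V F' hfam hcont
    have hzt : Tendsto z atTop (𝓝 (γ 0, γ 1)) := tendsto_iff_dist_tendsto_zero.2
      (squeeze_zero (fun _ => dist_nonneg) (fun n => (hzd n).le) hlim)
    obtain ⟨n, hn⟩ := (hzt.eventually (prod_mem_nhds hU'' hV'')).exists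
    obtain ⟨m, hm, he⟩ := hF'pos (z n).1 (z n).2 ⟨n, rfl⟩
    have hpe := hag _ hn.1 _ hn.2
    rw [he] at hpe
    apply hne m
    rw [hm]
    exact hpe

end
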